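/- Let g̃ be a C³ Riemannian metric on {y ∈ ℝ³ : |y| > 1}, given by a positive-definite symmetric matrix-valued function, satisfying the decay |∂^α (g̃_{ij} − δ_{ij})(y)| ≤ C |y|^{-1-|α|} for all multi-indices |α| ≤ 3, and suppose the coordinates are asymptotically harmonic in the sense that the functions H^m := g̃^{jk} Γ̃^m_{jk} satisfy |H^m(y)| ≤ C |y|^{-3} and |∂ H^m(y)| ≤ C |y|^{-4}. Then there exists C' > 0 such that |R(g̃)(y) + (1/2) Δ_{g̃} log det g̃(y)| ≤ C' |y|^{-4} for all |y| > 2; that is, −(1/2) Δ_{g̃} log det g̃ = R(g̃) + O(|y|^{-4}). -/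

import Mathlib

open Real MeasureTheory Matrix

/-- Partial derivative `∂_i f` on Euclidean `ℝ³`. -/
noncomputable def pd3 (i : Fin 3) (f : EuclideanSpace ℝ (Fin 3) → ℝ)
    (x : EuclideanSpace ℝ (Fin 3)) : ℝ :=
  fderiv ℝ f x (EuclideanSpace.single i 1)

/-- The Laplace–Beltrami operator of a metric `g` (given as a matrix-valued function) in
coordinates: `Δ_g f = (det g)^{-1/2} ∂_i((det g)^{1/2} g^{ij} ∂_j f)`. -/
noncomputable def lapBel (g : EuclideanSpace ℝ (Fin 3) → Matrix (Fin 3) (Fin 3) ℝ)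
    (f : EuclideanSpace ℝ (Fin 3) → ℝ) (x : EuclideanSpace ℝ (Fin 3)) : ℝ :=
  (Real.sqrt (g x).det)⁻¹ *
    ∑ i, pd3 i (fun z => Real.sqrt (g z).det * ∑ j, ((g z)⁻¹ i j) * pd3 j f z) x

/-- The Christoffel symbols `Γ^k_{mn} = (1/2) g^{kl}(∂_m g_{nl} + ∂_n g_{ml} − ∂_l g_{mn})`. -/
noncomputable def christoffel (g : EuclideanSpace ℝ (Fin 3) → Matrix (Fin 3) (Fin 3) ℝ)
    (x : EuclideanSpace ℝ (Fin 3)) (k m n : Fin 3) : ℝ :=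
  (1 / 2) * ∑ l, ((g x)⁻¹ k l) *
    (pd3 m (fun z => g z n l) x + pd3 n (fun z => g z m l) x - pd3 l (fun z => g z m n) x)

/-- The contracted Christoffel symbols `H^m = g^{jk} Γ^m_{jk}` (which vanish exactly in harmonic
coordinates). -/
noncomputable def contractedChristoffel
    (g : EuclideanSpace ℝ (Fin 3) → Matrix (Fin 3) (Fin 3) ℝ) (m : Fin 3)
    (x : EuclideanSpace ℝ (Fin 3)) : ℝ :=
  ∑ j, ∑ k, ((g x)⁻¹ j k) * christoffel g x m j k

/-- The scalar curvature in coordinates: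
`R(g) = g^{jk}(∂_i Γ^i_{jk} − ∂_j Γ^i_{ik} + Γ^i_{ip} Γ^p_{jk} − Γ^i_{jp} Γ^p_{ik})`. -/
noncomputable def scalarCurv (g : EuclideanSpace ℝ (Fin 3) → Matrix (Fin 3) (Fin 3) ℝ)
    (x : EuclideanSpace ℝ (Fin 3)) : ℝ :=
  ∑ j, ∑ k, ((g x)⁻¹ j k) *
    ((∑ i, pd3 i (fun z => christoffel g z i j k) x) -
     (∑ i, pd3 j (fun z => christoffel g z i i k) x) +
     (∑ i, ∑ p, christoffel g x i i p * christoffel g x p j k) -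
     (∑ i, ∑ p, christoffel g x i j p * christoffel g x p i k))

section

local notation "E3" => EuclideanSpace ℝ (Fin 3)

theorem pd3_congr {f h : E3 → ℝ} {x : E3} (i : Fin 3) (e : f =ᶠ[nhds x] h) :
    pd3 i f x = pd3 i h x := by
  rw [pd3, pd3, e.fderiv_eq]

theorem pd3_mul {f h : E3 → ℝ} {x : E3} (i : Fin 3) (hf : DifferentiableAt ℝ f x)
    (hh : DifferentiableAt ℝ h x) :
    pd3 i (fun z => f z * h z) x = pd3 i f x * h x + f x * pd3 i h x := by
  simp only [pd3]
  rw [fderiv_fun_mul hf hh]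
  simp
  ring

theorem pd3_sum {f : Fin 3 → E3 → ℝ} {x : E3} (i : Fin 3)
    (hf : ∀ k, DifferentiableAt ℝ (f k) x) :
    pd3 i (fun z => ∑ k, f k z) x = ∑ k, pd3 i (f k) x := by
  simp only [pd3]
  rw [fderiv_fun_sum (fun k _ => hf k)]
  simp

theorem pd3_const (i : Fin 3) (c : ℝ) (x : E3) : pd3 i (fun _ => c) x = 0 := by
  simp [pd3]

theorem ContDiffAt.pd3 {f : E3 → ℝ} {x : E3} {n m : WithTop ℕ∞} (i : Fin 3)
    (hf : ContDiffAt ℝ n f x) (hmn : m + 1 ≤ n) : ContDiffAt ℝ m (pd3 i f) x :=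
  (hf.fderiv_right hmn).clm_apply contDiffAt_const

theorem abs_pd3_le (f : E3 → ℝ) (x : E3) (i : Fin 3) (c : ℝ) :
    |pd3 i f x| ≤ ‖iteratedFDeriv ℝ 1 (fun z => f z - c) x‖ := by
  have h : ‖iteratedFDeriv ℝ 1 (fun z => f z - c) x‖ = ‖fderiv ℝ f x‖ := by
    rw [← zero_add 1, ← norm_iteratedFDeriv_fderiv, norm_iteratedFDeriv_zero, fderiv_sub_const]
  rw [h]
  simpa [pd3] using (fderiv ℝ f x).le_opNorm (EuclideanSpace.single i 1)

theorem Matrix.contDiffAt_det_fin_three {g : E3 → Matrix (Fin 3) (Fin 3) ℝ} {x : E3}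
    {n : WithTop ℕ∞} (hg : ∀ i j, ContDiffAt ℝ n (fun z => g z i j) x) :
    ContDiffAt ℝ n (fun z => (g z).det) x := by
  simp only [det_fin_three]
  have h := hg
  fun_prop

theorem Matrix.inv_fin_three_apply (M : Matrix (Fin 3) (Fin 3) ℝ) (i j : Fin 3) :
    M⁻¹ i j = M.det⁻¹ * M.adjugate i j := by
  simp [Matrix.inv_def]

theorem Matrix.contDiffAt_inv_fin_three {g : E3 → Matrix (Fin 3) (Fin 3) ℝ} {x : E3}
    {n : WithTop ℕ∞} (hg : ∀ i j, ContDiffAt ℝ n (fun z => g z i j) x)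
    (hdet : (g x).det ≠ 0) (i j : Fin 3) :
    ContDiffAt ℝ n (fun z => (g z)⁻¹ i j) x := by
  simp only [Matrix.inv_fin_three_apply]
  refine ((contDiffAt_det_fin_three hg).inv hdet).mul ?_
  simp only [adjugate_fin_three]
  have h := hg
  fin_cases i <;> fin_cases j <;> simp <;> fun_prop

theorem pd3_det {g : E3 → Matrix (Fin 3) (Fin 3) ℝ} {x : E3}
    (hg : ∀ i j, DifferentiableAt ℝ (fun z => g z i j) x) (hdet : (g x).det ≠ 0) (k : Fin 3) :
    pd3 k (fun z => (g z).det) x =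
      (g x).det * ∑ a, ∑ b, (g x)⁻¹ a b * pd3 k (fun z => g z b a) x := by
  have h := fun i j => (hg i j).hasFDerivAt
  have hd := (((((((h 0 0).mul (h 1 1)).mul (h 2 2)).sub (((h 0 0).mul (h 1 2)).mul (h 2 1))).sub
    (((h 0 1).mul (h 1 0)).mul (h 2 2))).add (((h 0 1).mul (h 1 2)).mul (h 2 0))).add
    (((h 0 2).mul (h 1 0)).mul (h 2 1))).sub (((h 0 2).mul (h 1 1)).mul (h 2 0))
  have e : (fun z => (g z).det) = _ := funext fun z => det_fin_three (g z)
  have e2 : ∑ a, ∑ b, (g x)⁻¹ a b * pd3 k (fun z => g z b a) x =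
      (g x).det⁻¹ * ∑ a, ∑ b, (g x).adjugate a b * pd3 k (fun z => g z b a) x := by
    simp only [Matrix.inv_fin_three_apply, Finset.mul_sum, mul_assoc]
  rw [e2, mul_inv_cancel_left₀ hdet, e, pd3]
  erw [hd.fderiv]
  simp [Fin.sum_univ_three, adjugate_fin_three, pd3]
  ring

theorem pd3_log_det {g : E3 → Matrix (Fin 3) (Fin 3) ℝ} {x : E3}
    (hg : ∀ i j, DifferentiableAt ℝ (fun z => g z i j) x)
    (hd : DifferentiableAt ℝ (fun z => (g z).det) x) (hdet : (g x).det ≠ 0) (k : Fin 3) :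
    pd3 k (fun z => Real.log (g z).det) x =
      ∑ a, ∑ b, (g x)⁻¹ a b * pd3 k (fun z => g z b a) x := by
  have h := pd3_det hg hdet k
  have h2 : pd3 k (fun z => Real.log (g z).det) x =
      (g x).det⁻¹ * pd3 k (fun z => (g z).det) x := by
    simp only [pd3]
    rw [fderiv.log hd hdet]
    simp
  rw [h2, h, inv_mul_cancel_left₀ hdet]

theorem pd3_sqrt_det {g : E3 → Matrix (Fin 3) (Fin 3) ℝ} {x : E3}
    (hd : DifferentiableAt ℝ (fun z => (g z).det) x) (hdet : 0 < (g x).det) (k : Fin 3) :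
    pd3 k (fun z => Real.sqrt (g z).det) x =
      Real.sqrt (g x).det * ((1 / 2) * pd3 k (fun z => Real.log (g z).det) x) := by
  simp only [pd3]
  rw [fderiv.log hd hdet.ne', fderiv_sqrt hd hdet.ne']
  have h1 : Real.sqrt (g x).det ≠ 0 := (Real.sqrt_pos.2 hdet).ne'
  have h2 : ((g x).det)⁻¹ = (Real.sqrt (g x).det)⁻¹ * (Real.sqrt (g x).det)⁻¹ := by
    rw [← mul_inv, Real.mul_self_sqrt hdet.le]
  rw [h2]
  simp
  field_simp

theorem pd3_inv {g : E3 → Matrix (Fin 3) (Fin 3) ℝ} {x : E3}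
    (hg : ∀ i j, DifferentiableAt ℝ (fun z => g z i j) x)
    (hA : ∀ i j, DifferentiableAt ℝ (fun z => (g z)⁻¹ i j) x)
    (hdet : ∀ᶠ z in nhds x, (g z).det ≠ 0) (k i j : Fin 3) :
    pd3 k (fun z => (g z)⁻¹ i j) x =
      -∑ b, (∑ a, (g x)⁻¹ i a * pd3 k (fun z => g z a b) x) * (g x)⁻¹ b j := by
  have h1 : ∀ b, ∑ a, (pd3 k (fun z => (g z)⁻¹ i a) x * g x a b +
      (g x)⁻¹ i a * pd3 k (fun z => g z a b) x) = 0 := by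
    intro b
    rw [← pd3_const k ((1 : Matrix (Fin 3) (Fin 3) ℝ) i b) x]
    rw [← pd3_congr k (f := fun z => ∑ a, (g z)⁻¹ i a * g z a b)]
    · rw [pd3_sum k fun a => (hA i a).fun_mul (hg a b)]
      exact Finset.sum_congr rfl fun a _ => (pd3_mul k (hA i a) (hg a b)).symm
    · filter_upwards [hdet] with z hz
      rw [← Matrix.mul_apply, Matrix.nonsing_inv_mul _ hz.isUnit]
  set P : Matrix (Fin 3) (Fin 3) ℝ := Matrix.of fun a b => pd3 k (fun z => (g z)⁻¹ a b) x with hP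
  have h2 : ∀ b, ∑ a, (g x)⁻¹ i a * pd3 k (fun z => g z a b) x = -(P * g x) i b := by
    intro b
    have := h1 b
    rw [Finset.sum_add_distrib] at this
    rw [Matrix.mul_apply]
    simp only [hP, Matrix.of_apply]
    linarith
  simp only [h2, neg_mul, Finset.sum_neg_distrib, neg_neg]
  rw [← Matrix.mul_apply, Matrix.mul_assoc, Matrix.mul_nonsing_inv _ hdet.self_of_nhds.isUnit,
    Matrix.mul_one]
  rfl

theorem sum_christoffel_trace {g : E3 → Matrix (Fin 3) (Fin 3) ℝ} {x : E3}
    (hs : ∀ᶠ z in nhds x, (g z).IsSymm) (k : Fin 3) :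
    ∑ i, christoffel g x i i k =
      (1 / 2) * ∑ a, ∑ b, (g x)⁻¹ a b * pd3 k (fun z => g z b a) x := by
  have hp : ∀ m a b, pd3 m (fun z => g z a b) x = pd3 m (fun z => g z b a) x := fun m a b =>
    pd3_congr m (hs.mono fun z hz => hz.apply b a)
  have hi : ∀ a b, (g x)⁻¹ a b = (g x)⁻¹ b a := fun a b =>
    (Matrix.IsSymm.inv hs.self_of_nhds).apply b a
  have hc : ∑ i, ∑ l, (g x)⁻¹ i l * pd3 i (fun z => g z k l) x =
      ∑ i, ∑ l, (g x)⁻¹ i l * pd3 l (fun z => g z i k) x := by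
    rw [Finset.sum_comm]
    refine Finset.sum_congr rfl fun i _ => Finset.sum_congr rfl fun l _ => ?_
    rw [hi l i, hp l k i]
  simp only [christoffel, mul_add, mul_sub, Finset.sum_add_distrib, Finset.sum_sub_distrib,
    ← Finset.mul_sum]
  rw [hc]
  simp only [hp k _ _]
  simp only [add_sub_cancel_left]

theorem abs_sum_fin_three_le {f : Fin 3 → ℝ} {B : ℝ} (h : ∀ i, |f i| ≤ B) :
    |∑ i, f i| ≤ 3 * B := by
  refine (Finset.abs_sum_le_sum_abs _ _).trans ?_
  simpa using Finset.sum_le_card_nsmul Finset.univ (fun i => |f i|) B fun i _ => h i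

theorem Matrix.continuousAt_inv_fin_three {M : Matrix (Fin 3) (Fin 3) ℝ} (hM : M.det ≠ 0)
    (i j : Fin 3) : ContinuousAt (fun N : Matrix (Fin 3) (Fin 3) ℝ => N⁻¹ i j) M := by
  simp only [Matrix.inv_fin_three_apply]
  have h1 : Continuous fun N : Matrix (Fin 3) (Fin 3) ℝ => N.det := continuous_id.matrix_det
  have h2 : Continuous fun N : Matrix (Fin 3) (Fin 3) ℝ => N.adjugate i j :=
    continuous_id.matrix_adjugate.matrix_elem i j
  exact (h1.continuousAt.inv₀ hM).mul h2.continuousAt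

theorem exists_abs_inv_le {g : E3 → Matrix (Fin 3) (Fin 3) ℝ}
    (hlim : ∀ i j, Filter.Tendsto (fun z => g z i j) (Filter.cocompact E3)
      (nhds ((1 : Matrix (Fin 3) (Fin 3) ℝ) i j)))
    {s : Set E3} (hs : IsClosed s) (i j : Fin 3)
    (hc : ContinuousOn (fun z => (g z)⁻¹ i j) s) :
    ∃ K, ∀ y ∈ s, |(g y)⁻¹ i j| ≤ K := by
  have hg : Filter.Tendsto g (Filter.cocompact E3) (nhds 1) :=
    tendsto_pi_nhds.2 fun i => tendsto_pi_nhds.2 fun j => hlim i j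
  have hA := ((Matrix.continuousAt_inv_fin_three (M := 1) (by simp) i j).tendsto.comp hg).abs
  have hev := hA.eventually_le_const (lt_add_one _)
  obtain ⟨t, ht, hts⟩ := Filter.mem_cocompact.1 hev
  obtain ⟨K, hK⟩ := (ht.inter_right hs).exists_bound_of_continuousOn
    (hc.mono Set.inter_subset_right)
  refine ⟨max K (|(1 : Matrix (Fin 3) (Fin 3) ℝ)⁻¹ i j| + 1), fun y hy => ?_⟩
  by_cases hyt : y ∈ t
  · exact le_max_of_le_left (hK y ⟨hyt, hy⟩)
  · exact le_max_of_le_right (hts hyt)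

theorem scalarCurv_add_lapBel {g : E3 → Matrix (Fin 3) (Fin 3) ℝ} {x : E3}
    (hg : ∀ i j, ContDiffAt ℝ 3 (fun z => g z i j) x)
    (hs : ∀ᶠ z in nhds x, (g z).IsSymm) (hdet : ∀ᶠ z in nhds x, 0 < (g z).det)
    {u : E3 → ℝ} (hu : u = fun z => Real.log (g z).det) :
    scalarCurv g x + (1 / 2) * lapBel g u x =
      (∑ i, pd3 i (contractedChristoffel g i) x) -
      (∑ i, ∑ j, ∑ k, pd3 i (fun z => (g z)⁻¹ j k) x * christoffel g x i j k) +
      (∑ j, ∑ k, (g x)⁻¹ j k * ∑ i, ∑ p, christoffel g x i i p * christoffel g x p j k) -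
      (∑ j, ∑ k, (g x)⁻¹ j k * ∑ i, ∑ p, christoffel g x i j p * christoffel g x p i k) +
      (1 / 4) * (∑ i, ∑ j, (g x)⁻¹ i j * (pd3 i u x * pd3 j u x)) +
      (1 / 2) * (∑ i, ∑ j, pd3 i (fun z => (g z)⁻¹ i j) x * pd3 j u x) := by
  have hdx : 0 < (g x).det := hdet.self_of_nhds
  have hA : ∀ i j, ContDiffAt ℝ 3 (fun z => (g z)⁻¹ i j) x :=
    Matrix.contDiffAt_inv_fin_three hg hdx.ne'
  have hD : ContDiffAt ℝ 3 (fun z => (g z).det) x := Matrix.contDiffAt_det_fin_three hg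
  have hA' : ∀ i j, DifferentiableAt ℝ (fun z => (g z)⁻¹ i j) x := fun i j =>
    (hA i j).differentiableAt (by norm_num)
  have hD' : DifferentiableAt ℝ (fun z => (g z).det) x := hD.differentiableAt (by norm_num)
  have hu3 : ContDiffAt ℝ 3 u x := hu ▸ hD.log hdx.ne'
  have hpg : ∀ m i j, DifferentiableAt ℝ (pd3 m (fun z => g z i j)) x := fun m i j =>
    ((hg i j).pd3 (m := 2) m (by norm_num)).differentiableAt (by norm_num)
  have hpu : ∀ m, DifferentiableAt ℝ (pd3 m u) x := fun m =>
    (hu3.pd3 (m := 2) m (by norm_num)).differentiableAt (by norm_num)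
  have hG : ∀ i j k, DifferentiableAt ℝ (fun z => christoffel g z i j k) x := by
    intro i j k
    exact (DifferentiableAt.fun_sum fun l _ => (hA' i l).fun_mul
      (((hpg j k l).fun_add (hpg k j l)).fun_sub (hpg l j k))).const_mul _
  have hgn : ∀ᶠ z in nhds x, ∀ i j, DifferentiableAt ℝ (fun z => g z i j) z := by
    simp only [Filter.eventually_all]
    intro i j
    filter_upwards [(hg i j).eventually (by simp)] with z hz
    exact hz.differentiableAt (by norm_num)
  have htr : ∀ j k, ∑ i, pd3 j (fun z => christoffel g z i i k) x =
      (1 / 2) * pd3 j (pd3 k u) x := by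
    intro j k
    have hsum := pd3_sum (f := fun i z => christoffel g z i i k) j fun i => hG i i k
    have hhalf : pd3 j (fun z => (1 / 2) * pd3 k u z) x = (1 / 2) * pd3 j (pd3 k u) x := by
      rw [pd3_mul j (differentiableAt_const _) (hpu k), pd3_const]
      ring
    refine hsum.symm.trans (Eq.trans (pd3_congr j ?_) hhalf)
    filter_upwards [hs.eventually_nhds, hdet, hgn] with z h1 h2 h3
    rw [sum_christoffel_trace h1, hu, pd3_log_det h3 ?_ h2.ne']
    simp only [det_fin_three]
    fun_prop
  have hH : ∀ i, pd3 i (contractedChristoffel g i) x =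
      ∑ j, ∑ k, (pd3 i (fun z => (g z)⁻¹ j k) x * christoffel g x i j k +
        (g x)⁻¹ j k * pd3 i (fun z => christoffel g z i j k) x) := by
    intro i
    change pd3 i (fun z => ∑ j, ∑ k, (g z)⁻¹ j k * christoffel g z i j k) x = _
    rw [pd3_sum i fun j => DifferentiableAt.fun_sum fun k _ => (hA' j k).fun_mul (hG i j k)]
    refine Finset.sum_congr rfl fun j _ => ?_
    rw [pd3_sum i fun k => (hA' j k).fun_mul (hG i j k)]
    exact Finset.sum_congr rfl fun k _ => pd3_mul i (hA' j k) (hG i j k)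
  have hL : lapBel g u x = ∑ i, ∑ j, ((1 / 2) * ((g x)⁻¹ i j * (pd3 i u x * pd3 j u x)) +
      pd3 i (fun z => (g z)⁻¹ i j) x * pd3 j u x + (g x)⁻¹ i j * pd3 i (pd3 j u) x) := by
    have hsq : Real.sqrt (g x).det ≠ 0 := (Real.sqrt_pos.2 hdx).ne'
    rw [lapBel, Finset.mul_sum]
    refine Finset.sum_congr rfl fun i _ => ?_
    rw [pd3_mul i (hD'.sqrt hdx.ne')
      (DifferentiableAt.fun_sum fun j _ => (hA' i j).fun_mul (hpu j)),
      pd3_sqrt_det hD' hdx, ← hu, pd3_sum i fun j => (hA' i j).fun_mul (hpu j)]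
    simp only [pd3_mul i (hA' i _) (hpu _)]
    rw [mul_assoc, ← mul_add, inv_mul_cancel_left₀ hsq, Finset.mul_sum,
      ← Finset.sum_add_distrib]
    exact Finset.sum_congr rfl fun j _ => by ring
  have hc : ∑ i, ∑ j, ∑ k, (g x)⁻¹ j k * pd3 i (fun z => christoffel g z i j k) x =
      ∑ j, ∑ k, (g x)⁻¹ j k * ∑ i, pd3 i (fun z => christoffel g z i j k) x := by
    rw [Finset.sum_comm]
    refine Finset.sum_congr rfl fun j _ => ?_
    rw [Finset.sum_comm]
    simp only [Finset.mul_sum]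
  have hq : ∑ j, ∑ k, (g x)⁻¹ j k * ((1 / 2) * pd3 j (pd3 k u) x) =
      (1 / 2) * ∑ j, ∑ k, (g x)⁻¹ j k * pd3 j (pd3 k u) x := by
    simp only [Finset.mul_sum]
    exact Finset.sum_congr rfl fun j _ => Finset.sum_congr rfl fun k _ => by ring
  rw [hL, scalarCurv]
  simp only [hH, htr, mul_add, mul_sub, Finset.sum_add_distrib, Finset.sum_sub_distrib]
  rw [hc, hq]
  simp only [← Finset.mul_sum]
  ring

theorem abs_christoffel_le {g : E3 → Matrix (Fin 3) (Fin 3) ℝ} {x : E3} {K B : ℝ}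
    (hA : ∀ i j, |(g x)⁻¹ i j| ≤ K) (hB : ∀ m i j, |pd3 m (fun z => g z i j) x| ≤ B)
    (k m n : Fin 3) : |christoffel g x k m n| ≤ 9 / 2 * (K * B) := by
  have hK : 0 ≤ K := (abs_nonneg _).trans (hA 0 0)
  have h : |∑ l, ((g x)⁻¹ k l) * (pd3 m (fun z => g z n l) x + pd3 n (fun z => g z m l) x -
      pd3 l (fun z => g z m n) x)| ≤ 3 * (K * (3 * B)) := by
    refine abs_sum_fin_three_le fun l => ?_
    rw [abs_mul]
    refine mul_le_mul (hA k l) ?_ (abs_nonneg _) hK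
    have h1 := abs_le.1 (hB m n l)
    have h2 := abs_le.1 (hB n m l)
    have h3 := abs_le.1 (hB l m n)
    exact abs_le.2 ⟨by linarith, by linarith⟩
  rw [christoffel, abs_mul, abs_of_pos (by norm_num : (0 : ℝ) < 1 / 2)]
  linarith

theorem abs_pd3_log_det_le {g : E3 → Matrix (Fin 3) (Fin 3) ℝ} {x : E3} {K B : ℝ}
    (hg : ∀ i j, DifferentiableAt ℝ (fun z => g z i j) x)
    (hd : DifferentiableAt ℝ (fun z => (g z).det) x) (hdet : (g x).det ≠ 0)
    (hA : ∀ i j, |(g x)⁻¹ i j| ≤ K) (hB : ∀ m i j, |pd3 m (fun z => g z i j) x| ≤ B)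
    (k : Fin 3) : |pd3 k (fun z => Real.log (g z).det) x| ≤ 9 * (K * B) := by
  have hK : 0 ≤ K := (abs_nonneg _).trans (hA 0 0)
  rw [pd3_log_det hg hd hdet, show 9 * (K * B) = 3 * (3 * (K * B)) by ring]
  refine abs_sum_fin_three_le fun a => abs_sum_fin_three_le fun b => ?_
  rw [abs_mul]
  exact mul_le_mul (hA a b) (hB k b a) (abs_nonneg _) hK

theorem abs_pd3_inv_le {g : E3 → Matrix (Fin 3) (Fin 3) ℝ} {x : E3} {K B : ℝ}
    (hg : ∀ i j, DifferentiableAt ℝ (fun z => g z i j) x)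
    (hA' : ∀ i j, DifferentiableAt ℝ (fun z => (g z)⁻¹ i j) x)
    (hdet : ∀ᶠ z in nhds x, (g z).det ≠ 0)
    (hA : ∀ i j, |(g x)⁻¹ i j| ≤ K) (hB : ∀ m i j, |pd3 m (fun z => g z i j) x| ≤ B)
    (k i j : Fin 3) : |pd3 k (fun z => (g z)⁻¹ i j) x| ≤ 9 * (K * B * K) := by
  have hK : 0 ≤ K := (abs_nonneg _).trans (hA 0 0)
  have hB0 : 0 ≤ B := (abs_nonneg _).trans (hB 0 0 0)
  rw [pd3_inv hg hA' hdet, abs_neg, show 9 * (K * B * K) = 3 * (3 * (K * B) * K) by ring]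
  refine abs_sum_fin_three_le fun b => ?_
  rw [abs_mul]
  refine mul_le_mul (abs_sum_fin_three_le fun a => ?_) (hA b j) (abs_nonneg _) (by positivity)
  rw [abs_mul]
  exact mul_le_mul (hA i a) (hB k a b) (abs_nonneg _) hK

theorem abs_scalarCurv_add_lapBel_le {g : E3 → Matrix (Fin 3) (Fin 3) ℝ} {x : E3}
    {K M N q : ℝ}
    (hg : ∀ i j, ContDiffAt ℝ 3 (fun z => g z i j) x)
    (hs : ∀ᶠ z in nhds x, (g z).IsSymm) (hdet : ∀ᶠ z in nhds x, 0 < (g z).det)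
    (hA : ∀ i j, |(g x)⁻¹ i j| ≤ K)
    (hG : ∀ i j k, |christoffel g x i j k| ≤ M * q)
    (hu : ∀ k, |pd3 k (fun z => Real.log (g z).det) x| ≤ M * q)
    (hpA : ∀ k i j, |pd3 k (fun z => (g z)⁻¹ i j) x| ≤ M * q)
    (hH : ∀ i, |pd3 i (contractedChristoffel g i) x| ≤ N * q ^ 2) :
    |scalarCurv g x + (1 / 2) * lapBel g (fun z => Real.log (g z).det) x| ≤
      (3 * N + 32 * M ^ 2 + 165 * K * M ^ 2) * q ^ 2 := by
  have hK : 0 ≤ K := (abs_nonneg _).trans (hA 0 0)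
  have hM : 0 ≤ M * q := (abs_nonneg _).trans (hu 0)
  have mul_bound : ∀ {a b c d : ℝ}, |a| ≤ c → |b| ≤ d → |a * b| ≤ c * d := by
    intro a b c d h1 h2
    rw [abs_mul]
    exact mul_le_mul h1 h2 (abs_nonneg _) ((abs_nonneg _).trans h1)
  rw [scalarCurv_add_lapBel hg hs hdet rfl]
  have h1 := abs_sum_fin_three_le fun i => hH i
  have h2 := abs_sum_fin_three_le fun i => abs_sum_fin_three_le fun j =>
    abs_sum_fin_three_le fun k => mul_bound (hpA i j k) (hG i j k)
  have h3 := abs_sum_fin_three_le fun j => abs_sum_fin_three_le fun k =>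
    mul_bound (hA j k) (abs_sum_fin_three_le fun i => abs_sum_fin_three_le fun p =>
      mul_bound (hG i i p) (hG p j k))
  have h4 := abs_sum_fin_three_le fun j => abs_sum_fin_three_le fun k =>
    mul_bound (hA j k) (abs_sum_fin_three_le fun i => abs_sum_fin_three_le fun p =>
      mul_bound (hG i j p) (hG p i k))
  have h5 := abs_sum_fin_three_le fun i => abs_sum_fin_three_le fun j =>
    mul_bound (hA i j) (mul_bound (hu i) (hu j))
  have h6 := abs_sum_fin_three_le fun i => abs_sum_fin_three_le fun j =>
    mul_bound (hpA i i j) (hu j)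
  have e1 : 0 ≤ K * (M * q * (M * q)) := by positivity
  have e2 : 0 ≤ M * q * (M * q) := by positivity
  rw [show (3 * N + 32 * M ^ 2 + 165 * K * M ^ 2) * q ^ 2 = 3 * (N * q ^ 2) +
    32 * (M * q * (M * q)) + 165 * (K * (M * q * (M * q))) by ring]
  rw [abs_le] at *
  constructor <;> linarith

end

/-- In asymptotically harmonic coordinates (`H^m = g̃^{jk} Γ̃^m_{jk} = O(|y|⁻³)`,
`∂H^m = O(|y|⁻⁴)`) for a `C³` metric `g̃ = δ + O(|y|⁻¹)` with derivative decay up to third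
order, the scalar curvature satisfies `−(1/2) Δ_{g̃} log det g̃ = R(g̃) + O(|y|⁻⁴)`. -/
theorem scalar_curvature_log_det_laplacian
    (g : EuclideanSpace ℝ (Fin 3) → Matrix (Fin 3) (Fin 3) ℝ) (C : ℝ)
    (hpos : ∀ y : EuclideanSpace ℝ (Fin 3), 1 < ‖y‖ → (g y).PosDef)
    (hsymm : ∀ y : EuclideanSpace ℝ (Fin 3), 1 < ‖y‖ → (g y).IsSymm)
    (hreg : ∀ i j : Fin 3,
      ContDiffOn ℝ 3 (fun y => g y i j) {y : EuclideanSpace ℝ (Fin 3) | 1 < ‖y‖})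
    (hdecay : ∀ n : ℕ, n ≤ 3 → ∀ i j : Fin 3, ∀ y : EuclideanSpace ℝ (Fin 3), 1 < ‖y‖ →
      ‖iteratedFDeriv ℝ n (fun z => g z i j - (if i = j then (1 : ℝ) else 0)) y‖ ≤
        C * ‖y‖ ^ (-(1 : ℝ) - n))
    (hharm : ∀ m : Fin 3, ∀ y : EuclideanSpace ℝ (Fin 3), 1 < ‖y‖ →
      |contractedChristoffel g m y| ≤ C * ‖y‖ ^ (-(3 : ℝ)))
    (hharm' : ∀ m i : Fin 3, ∀ y : EuclideanSpace ℝ (Fin 3), 1 < ‖y‖ →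
      |pd3 i (contractedChristoffel g m) y| ≤ C * ‖y‖ ^ (-(4 : ℝ))) :
    ∃ C' : ℝ, 0 < C' ∧ ∀ y : EuclideanSpace ℝ (Fin 3), 2 < ‖y‖ →
      |scalarCurv g y + (1 / 2) * lapBel g (fun z => Real.log (g z).det) y| ≤
        C' * ‖y‖ ^ (-(4 : ℝ)) := by
  have hopen : IsOpen {y : EuclideanSpace ℝ (Fin 3) | 1 < ‖y‖} :=
    isOpen_lt continuous_const continuous_norm
  have hg : ∀ y : EuclideanSpace ℝ (Fin 3), 1 < ‖y‖ → ∀ i j,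
      ContDiffAt ℝ 3 (fun z => g z i j) y := fun y hy i j =>
    (hreg i j).contDiffAt (hopen.mem_nhds hy)
  have hdet : ∀ y : EuclideanSpace ℝ (Fin 3), 1 < ‖y‖ → 0 < (g y).det := fun y hy =>
    (hpos y hy).det_pos
  have hA : ∀ y : EuclideanSpace ℝ (Fin 3), 1 < ‖y‖ → ∀ i j,
      ContDiffAt ℝ 3 (fun z => (g z)⁻¹ i j) y := fun y hy =>
    Matrix.contDiffAt_inv_fin_three (hg y hy) (hdet y hy).ne'
  have hlim : ∀ i j, Filter.Tendsto (fun z => g z i j)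
      (Filter.cocompact (EuclideanSpace ℝ (Fin 3)))
      (nhds ((1 : Matrix (Fin 3) (Fin 3) ℝ) i j)) := by
    intro i j
    have hn := tendsto_norm_cocompact_atTop (E := EuclideanSpace ℝ (Fin 3))
    have h0 := ((tendsto_rpow_neg_atTop one_pos).comp hn).const_mul C
    rw [mul_zero] at h0
    rw [tendsto_iff_norm_sub_tendsto_zero]
    refine squeeze_zero' (Filter.Eventually.of_forall fun _ => norm_nonneg _) ?_ h0
    filter_upwards [hn.eventually_gt_atTop 1] with y hy
    have h := hdecay 0 (by norm_num) i j y hy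
    rw [norm_iteratedFDeriv_zero] at h
    simpa [Matrix.one_apply] using h
  have hclosed : IsClosed {y : EuclideanSpace ℝ (Fin 3) | 2 ≤ ‖y‖} :=
    isClosed_le continuous_const continuous_norm
  choose K hK using fun i j => exists_abs_inv_le hlim hclosed i j fun y hy =>
    (hA y (lt_of_lt_of_le one_lt_two hy) i j).continuousAt.continuousWithinAt
  set L := ∑ i, ∑ j, |K i j| with hL
  have hKL : ∀ i j, K i j ≤ L := fun i j =>
    (le_abs_self _).trans <|
      (Finset.single_le_sum (f := fun j => |K i j|) (fun _ _ => abs_nonneg _)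
        (Finset.mem_univ j)).trans
      (Finset.single_le_sum (f := fun i => ∑ j, |K i j|)
        (fun _ _ => Finset.sum_nonneg fun _ _ => abs_nonneg _) (Finset.mem_univ i))
  have hL0 : 0 ≤ L := Finset.sum_nonneg fun _ _ => Finset.sum_nonneg fun _ _ => abs_nonneg _
  set M := 9 * (L * |C|) + 9 * (L * |C| * L) with hM
  refine ⟨3 * |C| + 32 * M ^ 2 + 165 * L * M ^ 2 + 1, by positivity, fun y hy => ?_⟩
  have hy1 : 1 < ‖y‖ := one_lt_two.trans hy
  have hy0 : 0 < ‖y‖ := one_pos.trans hy1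
  set q := ‖y‖ ^ (-(2 : ℝ)) with hq
  have hq0 : 0 ≤ q := by positivity
  have hq2 : ‖y‖ ^ (-(4 : ℝ)) = q ^ 2 := by
    rw [hq, ← Real.rpow_natCast, ← Real.rpow_mul hy0.le]
    norm_num
  have hnhds : ∀ᶠ z in nhds y, 1 < ‖z‖ := hopen.mem_nhds hy1
  have hAL : ∀ i j, |(g y)⁻¹ i j| ≤ L := fun i j => (hK i j y hy.le).trans (hKL i j)
  have hB : ∀ m i j, |pd3 m (fun z => g z i j) y| ≤ |C| * q := by
    intro m i j
    refine (abs_pd3_le _ y m _).trans ((hdecay 1 (by norm_num) i j y hy1).trans ?_)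
    rw [show (-(1 : ℝ) - (1 : ℕ)) = -2 by norm_num]
    exact mul_le_mul_of_nonneg_right (le_abs_self C) hq0
  have hg' : ∀ i j, DifferentiableAt ℝ (fun z => g z i j) y := fun i j =>
    (hg y hy1 i j).differentiableAt (by norm_num)
  have hA' : ∀ i j, DifferentiableAt ℝ (fun z => (g z)⁻¹ i j) y := fun i j =>
    (hA y hy1 i j).differentiableAt (by norm_num)
  have p1 : 0 ≤ L * |C| * q := by positivity
  have p2 : 0 ≤ L * |C| * L * q := by positivity
  have key := abs_scalarCurv_add_lapBel_le (K := L) (M := M) (N := |C|) (q := q) (hg y hy1)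
    (hnhds.mono hsymm) (hnhds.mono hdet) hAL
    (fun i j k => (abs_christoffel_le hAL hB i j k).trans (by rw [hM]; linarith))
    (fun k => (abs_pd3_log_det_le hg'
      ((Matrix.contDiffAt_det_fin_three (hg y hy1)).differentiableAt (by norm_num))
      (hdet y hy1).ne' hAL hB k).trans (by rw [hM]; linarith))
    (fun k i j => (abs_pd3_inv_le hg' hA' (hnhds.mono fun z hz => (hdet z hz).ne') hAL hB
      k i j).trans (by rw [hM]; linarith))
    (fun i => (hharm' i i y hy1).trans (by
      rw [hq2]; exact mul_le_mul_of_nonneg_right (le_abs_self C) (by positivity)))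
  rw [hq2]
  refine key.trans (mul_le_mul_of_nonneg_right ?_ (by positivity))
  linarith
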